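/- Let G be a vertex-weighted graph containing a 6-cycle v₁v₂v₃v₄v₅v₆ (edges v₁v₂, v₂v₃, v₃v₄, v₄v₅, v₅v₆, v₆v₁ on six distinct vertices) such that d(v₂)=d(v₃)=d(v₅)=d(v₆)=2, w(v₁) ≥ max{w(v₂),w(v₆)}, w(v₄) ≥ max{w(v₃),w(v₅)}, w(v₆) ≥ w(v₅), and w(v₂) ≥ w(v₃). Let G' be the graph obtained from G by removing v₅ and v₆ and replacing the weight of v₂ by w(v₂)+w(v₆) and the weight of v₃ by w(v₃)+w(v₅). Then α(G) = α(G'). -/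

import Mathlib

open scoped Classical

namespace MWIS

variable {V : Type*}

/-- A finset of vertices is an independent set of `G`. -/
def IsIndepSet (G : SimpleGraph V) (s : Finset V) : Prop :=
  ∀ ⦃a⦄, a ∈ s → ∀ ⦃b⦄, b ∈ s → ¬G.Adj a b

/-- The maximum total weight of an independent set of `G` contained in `A`
(i.e. α of the induced subgraph `G[A]`, with the inherited weights). -/
noncomputable def alphaOn [Fintype V] (G : SimpleGraph V) (w : V → ℝ) (A : Finset V) : ℝ :=
  sSup {x : ℝ | ∃ s : Finset V, s ⊆ A ∧ IsIndepSet G s ∧ x = ∑ v ∈ s, w v}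

/-- The maximum total weight of an independent set of `G`. -/
noncomputable def alpha [Fintype V] (G : SimpleGraph V) (w : V → ℝ) : ℝ :=
  alphaOn G w Finset.univ

/-- The open neighborhood of a vertex, as a finset. -/
noncomputable def nbrs [Fintype V] (G : SimpleGraph V) (v : V) : Finset V :=
  Finset.univ.filter fun u => G.Adj v u

/-- The degree of a vertex. -/
noncomputable def deg [Fintype V] (G : SimpleGraph V) (v : V) : ℕ :=
  (nbrs G v).card

/-- The closed neighborhood `N[v]` of a vertex. -/
noncomputable def closedNbrs [Fintype V] [DecidableEq V] (G : SimpleGraph V) (v : V) : Finset V :=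
  insert v (nbrs G v)

/-- The open neighborhood `N(A)` of a vertex set. -/
noncomputable def openNbhd [Fintype V] [DecidableEq V] (G : SimpleGraph V) (A : Finset V) :
    Finset V :=
  (A.biUnion fun v => nbrs G v) \ A

/-- The closed neighborhood `N[A]` of a vertex set. -/
noncomputable def closedNbhd [Fintype V] [DecidableEq V] (G : SimpleGraph V) (A : Finset V) :
    Finset V :=
  A ∪ A.biUnion fun v => nbrs G v

/-- `s` is a maximum weighted independent set of `G` with weights `w`. -/
def IsMWIS [Fintype V] (G : SimpleGraph V) (w : V → ℝ) (s : Finset V) : Prop :=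
  IsIndepSet G s ∧ ∀ t : Finset V, IsIndepSet G t → ∑ v ∈ t, w v ≤ ∑ v ∈ s, w v

/-- `A` is the vertex set of a connected component of the subgraph of `G` induced on `B`:
`A` is the set of vertices reachable from some `x ∈ B` by paths staying inside `B`. -/
def IsCompOf (G : SimpleGraph V) (B A : Finset V) : Prop :=
  ∃ x ∈ B, ∀ y, y ∈ A ↔ Relation.ReflTransGen (fun a b => a ∈ B ∧ b ∈ B ∧ G.Adj a b) x y

theorem eq_or_eq_of_deg_eq_two [Fintype V] {G : SimpleGraph V} {v a b x : V}
    (hd : deg G v = 2) (ha : G.Adj v a) (hb : G.Adj v b) (hab : a ≠ b) (hx : G.Adj v x) :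
    x = a ∨ x = b := by
  have hsub : ({a, b} : Finset V) ⊆ nbrs G v := by
    intro y hy
    rcases Finset.mem_insert.1 hy with rfl | hy
    · simpa [nbrs] using ha
    · rw [Finset.mem_singleton.1 hy]
      simpa [nbrs] using hb
  have heq := Finset.eq_of_subset_of_card_le hsub
    (by rw [Finset.card_pair hab]; exact hd.le)
  have hmem : x ∈ nbrs G v := by simpa [nbrs] using hx
  rw [← heq] at hmem
  simpa using hmem

theorem alphaOn_le_alphaOn [Fintype V] {G : SimpleGraph V} {w w' : V → ℝ} {A B : Finset V}
    (h : ∀ s ⊆ A, IsIndepSet G s →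
      ∃ t ⊆ B, IsIndepSet G t ∧ ∑ v ∈ s, w v ≤ ∑ v ∈ t, w' v) :
    alphaOn G w A ≤ alphaOn G w' B := by
  apply csSup_le
  · exact ⟨0, ∅, by simp, by simp [IsIndepSet], by simp⟩
  · rintro x ⟨s, hsA, hs, rfl⟩
    obtain ⟨t, htB, ht, hle⟩ := h s hsA hs
    refine hle.trans (le_csSup ?_ ⟨t, htB, ht, rfl⟩)
    refine ((Set.finite_range fun t : Finset V => ∑ v ∈ t, w' v).subset ?_).bddAbove
    rintro x ⟨t, -, -, rfl⟩
    exact ⟨t, rfl⟩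

theorem IsIndepSet.mono {G : SimpleGraph V} {s t : Finset V} (ht : IsIndepSet G t)
    (hst : s ⊆ t) : IsIndepSet G s :=
  fun _ ha _ hb => ht (hst ha) (hst hb)

theorem IsIndepSet.insert [DecidableEq V] {G : SimpleGraph V} {s : Finset V} {v : V}
    (hs : IsIndepSet G s) (hv : ∀ x ∈ s, ¬G.Adj v x) : IsIndepSet G (insert v s) := by
  intro a ha b hb hab
  rcases Finset.mem_insert.1 ha with rfl | has <;>
    rcases Finset.mem_insert.1 hb with rfl | hbs
  · exact G.irrefl hab
  · exact hv b hbs hab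
  · exact hv a has hab.symm
  · exact hs has hbs hab

/-- for a 6-cycle `v₁v₂v₃v₄v₅v₆` with `d(v₂)=d(v₃)=d(v₅)=d(v₆)=2`,
`w(v₁) ≥ max{w(v₂), w(v₆)}`, `w(v₄) ≥ max{w(v₃), w(v₅)}`, `w(v₆) ≥ w(v₅)` and
`w(v₂) ≥ w(v₃)`: remove `v₅, v₆` and replace the weights of `v₂, v₃` by
`w(v₂)+w(v₆)` and `w(v₃)+w(v₅)`. Then `α(G) = α(G')`. -/
theorem stmt11 [Fintype V] [DecidableEq V] (G : SimpleGraph V) (w : V → ℝ)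
    (hw : ∀ x, 0 < w x) (v₁ v₂ v₃ v₄ v₅ v₆ : V)
    (hdist : List.Pairwise (· ≠ ·) [v₁, v₂, v₃, v₄, v₅, v₆])
    (e12 : G.Adj v₁ v₂) (e23 : G.Adj v₂ v₃) (e34 : G.Adj v₃ v₄) (e45 : G.Adj v₄ v₅)
    (e56 : G.Adj v₅ v₆) (e61 : G.Adj v₆ v₁)
    (hd2 : deg G v₂ = 2) (hd3 : deg G v₃ = 2) (hd5 : deg G v₅ = 2) (hd6 : deg G v₆ = 2)
    (hw1 : max (w v₂) (w v₆) ≤ w v₁) (hw4 : max (w v₃) (w v₅) ≤ w v₄)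
    (hw65 : w v₅ ≤ w v₆) (hw23 : w v₃ ≤ w v₂) :
    alpha G w =
      alphaOn G (Function.update (Function.update w v₂ (w v₂ + w v₆)) v₃ (w v₃ + w v₅))
        (Finset.univ \ {v₅, v₆}) := by
  simp only [List.pairwise_cons, List.mem_cons, List.not_mem_nil, or_false, forall_eq_or_imp,
    forall_eq, ne_eq] at hdist
  obtain ⟨⟨n12, n13, n14, n15, n16⟩, ⟨n23, n24, n25, n26⟩, ⟨n34, n35, n36⟩, ⟨n45, n46⟩, n56, -⟩ :=
    hdist
  have nb2 {x} := eq_or_eq_of_deg_eq_two (x := x) hd2 e12.symm e23 n13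
  have nb3 {x} := eq_or_eq_of_deg_eq_two (x := x) hd3 e23.symm e34 n24
  have nb5 {x} := eq_or_eq_of_deg_eq_two (x := x) hd5 e45.symm e56 n46
  have nb6 {x} := eq_or_eq_of_deg_eq_two (x := x) hd6 e56.symm e61 (Ne.symm n15)
  set w' := Function.update (Function.update w v₂ (w v₂ + w v₆)) v₃ (w v₃ + w v₅) with hw'
  have w2 : w' v₂ = w v₂ + w v₆ := by simp [hw', n23]
  have w3 : w' v₃ = w v₃ + w v₅ := by simp [hw']
  have wo {x} (h2 : x ≠ v₂) (h3 : x ≠ v₃) : w' x = w x := by simp [hw', h2, h3]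
  apply le_antisymm
  · refine alphaOn_le_alphaOn fun s _ hs => ?_
    set K : Finset V := {v₂, v₃, v₅, v₆} with hK
    have hB : IsIndepSet G (s \ K) := hs.mono Finset.sdiff_subset
    have hBw : ∑ v ∈ s \ K, w' v = ∑ v ∈ s \ K, w v :=
      Finset.sum_congr rfl fun x hx => by
        simp only [hK, Finset.mem_sdiff, Finset.mem_insert, Finset.mem_singleton, not_or] at hx
        exact wo hx.2.1 hx.2.2.1
    have hsw : ∑ v ∈ s, w v = ∑ v ∈ s \ K, w v +
        ((if v₂ ∈ s then w v₂ else 0) + ((if v₃ ∈ s then w v₃ else 0) +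
          ((if v₅ ∈ s then w v₅ else 0) + if v₆ ∈ s then w v₆ else 0))) := by
      rw [← Finset.sum_inter_add_sum_sdiff s K w, add_comm, Finset.inter_comm s K,
        ← Finset.sum_ite_mem, hK,
        Finset.sum_insert (by simp [n23, n25, n26]), Finset.sum_insert (by simp [n35, n36]),
        Finset.sum_pair n56]
    have p2 := hw v₂
    have p3 := hw v₃
    have p5 := hw v₅
    have p6 := hw v₆
    have a23 : v₂ ∈ s → v₃ ∉ s := fun h h' => hs h h' e23
    have a56 : v₅ ∈ s → v₆ ∉ s := fun h h' => hs h h' e56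
    by_cases h1 : v₁ ∈ s
    · have h2 : v₂ ∉ s := fun h => hs h1 h e12
      have h6 : v₆ ∉ s := fun h => hs h h1 e61
      by_cases h4 : v₄ ∈ s
      · have h3 : v₃ ∉ s := fun h => hs h h4 e34
        have h5 : v₅ ∉ s := fun h => hs h4 h e45
        refine ⟨s \ K, fun x hx => ?_, hB, ?_⟩
        · simp_all
        · rw [hBw, hsw]
          simp [h2, h3, h5, h6]
      · refine ⟨insert v₃ (s \ K), fun x hx => ?_, hB.insert fun x hx hadj => ?_, ?_⟩
        · simp only [hK, Finset.mem_insert, Finset.mem_sdiff, Finset.mem_singleton,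
            Finset.mem_univ] at hx ⊢
          grind
        · rcases nb3 hadj with rfl | rfl <;> simp_all
        · rw [Finset.sum_insert (by simp [hK]), hBw, hsw, w3]
          simp only [h2, h6, if_false]
          split_ifs <;> linarith
    · refine ⟨insert v₂ (s \ K), fun x hx => ?_, hB.insert fun x hx hadj => ?_, ?_⟩
      · simp only [hK, Finset.mem_insert, Finset.mem_sdiff, Finset.mem_singleton,
          Finset.mem_univ] at hx ⊢
        grind
      · rcases nb2 hadj with rfl | rfl <;> simp_all
      · rw [Finset.sum_insert (by simp [hK]), hBw, hsw, w2]
        split_ifs <;> first | linarith | simp_all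
  · refine alphaOn_le_alphaOn fun t htA ht => ?_
    have h5 : v₅ ∉ t := fun h => by simpa using htA h
    have h6 : v₆ ∉ t := fun h => by simpa using htA h
    by_cases h2 : v₂ ∈ t
    · have h3 : v₃ ∉ t := fun h => ht h2 h e23
      have h1 : v₁ ∉ t := fun h => ht h h2 e12
      refine ⟨insert v₆ t, Finset.subset_univ _, ht.insert fun x hx hadj => ?_, ?_⟩
      · rcases nb6 hadj with rfl | rfl <;> contradiction
      · have hrest : ∑ v ∈ t.erase v₂, w' v = ∑ v ∈ t.erase v₂, w v :=
          Finset.sum_congr rfl fun x hx =>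
            wo (Finset.ne_of_mem_erase hx) fun h => h3 (h ▸ Finset.mem_of_mem_erase hx)
        rw [Finset.sum_insert h6, ← Finset.add_sum_erase t w' h2, ← Finset.add_sum_erase t w h2,
          hrest, w2]
        linarith
    · by_cases h3 : v₃ ∈ t
      · have h4 : v₄ ∉ t := fun h => ht h3 h e34
        refine ⟨insert v₅ t, Finset.subset_univ _, ht.insert fun x hx hadj => ?_, ?_⟩
        · rcases nb5 hadj with rfl | rfl <;> contradiction
        · have hrest : ∑ v ∈ t.erase v₃, w' v = ∑ v ∈ t.erase v₃, w v :=
            Finset.sum_congr rfl fun x hx =>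
              wo (fun h => h2 (h ▸ Finset.mem_of_mem_erase hx)) (Finset.ne_of_mem_erase hx)
          rw [Finset.sum_insert h5, ← Finset.add_sum_erase t w' h3,
            ← Finset.add_sum_erase t w h3, hrest, w3]
          linarith
      · refine ⟨t, Finset.subset_univ _, ht, (Finset.sum_congr rfl fun x hx => ?_).le⟩
        exact wo (fun h => h2 (h ▸ hx)) (fun h => h3 (h ▸ hx))

end MWIS
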